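/- arXiv:1606.04825 — 4 statements merged into one kernel-verified Lean document; each statement's English description precedes it below -/
import Mathlib

section
/- Let T be a set, let L : T × [0,∞] → ℝ be such that for every x ∈ T the function t ↦ L(x,t) is nondecreasing with L(x,0) = 0, and write ℓ(x) = L(x,∞); assume ℓ(x) < ∞ for all x. Let t : T × T → [0,∞] be a symmetric function with t(x,x) = ∞ for all x, satisfying (i) t(x,z) ≥ min(t(x,y), t(y,z)) for all x,y,z ∈ T, and (ii) L(x, t(x,y)) = L(y, t(x,y)) for all x,y ∈ T. Define D(x,y) = ℓ(x) + ℓ(y) − 2·L(x, t(x,y)). Then D is a pseudometric on T: D(x,x) = 0, D(x,y) = D(y,x) ≥ 0, and D(x,z) ≤ D(x,y) + D(y,z) for all x,y,z ∈ T. -/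
open scoped ENNReal

/-- The cut-tree distance `D(x,y) = ℓ(x) + ℓ(y) − 2 L(x, t(x,y))` built from a
time-integrated mass function `L` and first separation times `t` is a pseudometric. -/
theorem cutTree_D_pseudometric {T : Type*}
    (L : T → ℝ≥0∞ → ℝ)
    (hmono : ∀ x, Monotone (L x))
    (hzero : ∀ x, L x 0 = 0)
    (t : T → T → ℝ≥0∞)
    (hsymm : ∀ x y, t x y = t y x)
    (hdiag : ∀ x, t x x = ⊤)
    (hmin : ∀ x y z, min (t x y) (t y z) ≤ t x z)
    (hL : ∀ x y, L x (t x y) = L y (t x y))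
    (D : T → T → ℝ)
    (hD : ∀ x y, D x y = L x ⊤ + L y ⊤ - 2 * L x (t x y)) :
    (∀ x, D x x = 0) ∧ (∀ x y, D x y = D y x) ∧ (∀ x y, 0 ≤ D x y) ∧
      (∀ x y z, D x z ≤ D x y + D y z) := by
  refine ⟨fun x => ?_, fun x y => ?_, fun x y => ?_, fun x y z => ?_⟩
  · rw [hD, hdiag]
    ring
  · rw [hD, hD, hsymm y x, hL x y]
    ring
  · rw [hD]
    have hx := hmono x (le_top : t x y ≤ ⊤)
    have hy := hmono y (le_top : t x y ≤ ⊤)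
    linarith [hL x y]
  · rw [hD, hD, hD]
    have hxyz := hmin x y z
    rcases le_total (t x y) (t y z) with h | h
    · rw [min_eq_left h] at hxyz
      linarith [hmono x hxyz, hmono y (le_top : t y z ≤ ⊤)]
    · rw [min_eq_right h] at hxyz
      linarith [hmono z hxyz, hmono y (le_top : t x y ≤ ⊤), hL x y, hL y z, hL x z]
end

section
/- Let D be a metric on ℕ (with 0 playing the role of the root). Suppose (R, d_R) and (R', d_{R'}) are R-trees equipped with points (x_i)_{i∈ℕ} ⊆ R and (x'_i)_{i∈ℕ} ⊆ R' such that d_R(x_i, x_j) = D(i,j) = d_{R'}(x'_i, x'_j) for all i, j ∈ ℕ, and such that R = ⋃_{i≥1} [[x_0, x_i]] and R' = ⋃_{i≥1} [[x'_0, x'_i]]. Then there exists a bijective isometry φ : R → R' with φ(x_i) = x'_i for all i ∈ ℕ. -/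
open Set

/-- `f` parametrizes the geodesic from `u` to `v` by arclength: it is an isometry
of `[0, d(u,v)]` into the space, sending `0` to `u` and `d(u,v)` to `v`. -/
def IsSegParam {T : Type*} [MetricSpace T] (u v : T) (f : ℝ → T) : Prop :=
  f 0 = u ∧ f (dist u v) = v ∧
    ∀ s ∈ Icc (0 : ℝ) (dist u v), ∀ t ∈ Icc (0 : ℝ) (dist u v),
      dist (f s) (f t) = |s - t|

/-- The segment `[[u,v]]`: the image of `[0, d(u,v)]` under any arclength
parametrization of the geodesic from `u` to `v`. -/
def rSeg {T : Type*} [MetricSpace T] (u v : T) : Set T :=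
  {x | ∃ f, IsSegParam u v f ∧ x ∈ f '' Icc (0 : ℝ) (dist u v)}

/-- A metric space is an `ℝ`-tree if every pair of points is joined by a unique
arclength-parametrized geodesic, and every continuous injective arc between two
points has image equal to the segment `[[u,v]]` between them. -/
structure IsRTree (T : Type*) [MetricSpace T] : Prop where
  exists_param : ∀ u v : T, ∃ f, IsSegParam u v f
  param_unique : ∀ (u v : T) (f g : ℝ → T), IsSegParam u v f → IsSegParam u v g →
    EqOn f g (Icc 0 (dist u v))
  arc_eq_seg : ∀ (u v : T) (g : ℝ → T), ContinuousOn g (Icc 0 1) → InjOn g (Icc 0 1) →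
    g 0 = u → g 1 = v → g '' Icc 0 1 = rSeg u v

section Segments

variable {T : Type*} [MetricSpace T] {p u v : T} {f g : ℝ → T}

theorem IsSegParam.continuousOn (hf : IsSegParam u v f) :
    ContinuousOn f (Icc 0 (dist u v)) := by
  refine (LipschitzOnWith.of_dist_le_mul (K := 1) fun s hs t ht => ?_).continuousOn
  simp [hf.2.2 s hs t ht, Real.dist_eq]

theorem IsSegParam.dist_left (hf : IsSegParam u v f) {s : ℝ} (hs : s ∈ Icc 0 (dist u v)) :
    dist u (f s) = s := by
  have h := hf.2.2 0 ⟨le_rfl, dist_nonneg⟩ s hs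
  rwa [hf.1, zero_sub, abs_neg, abs_of_nonneg hs.1] at h

/-- The initial piece of a geodesic is a geodesic. -/
theorem IsSegParam.restrict (hf : IsSegParam u v f) {s : ℝ} (hs : s ∈ Icc 0 (dist u v)) :
    IsSegParam u (f s) f := by
  have h := hf.dist_left hs
  refine ⟨hf.1, by rw [h], fun a ha b hb => ?_⟩
  rw [h] at ha hb
  exact hf.2.2 a ⟨ha.1, ha.2.trans hs.2⟩ b ⟨hb.1, hb.2.trans hs.2⟩

theorem dist_add_dist_of_mem_rSeg {z : T} (hz : z ∈ rSeg u v) :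
    dist u z + dist z v = dist u v := by
  obtain ⟨f, hf, s, hs, rfl⟩ := hz
  have h := hf.2.2 s hs (dist u v) ⟨dist_nonneg, le_rfl⟩
  rw [hf.2.1, abs_sub_comm, abs_of_nonneg (sub_nonneg.2 hs.2)] at h
  rw [hf.dist_left hs, h]
  ring

/-- Two geodesics from the same point that coincide at time `s` coincide up to time `s`. -/
theorem IsRTree.eqOn_of_eq (hT : IsRTree T) (hf : IsSegParam p u f) (hg : IsSegParam p v g)
    {s : ℝ} (hsu : s ∈ Icc 0 (dist p u)) (hsv : s ∈ Icc 0 (dist p v)) (h : f s = g s) :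
    EqOn f g (Icc 0 s) := by
  have h1 := hf.restrict hsu
  have h2 := hg.restrict hsv
  rw [← h] at h2
  simpa [hf.dist_left hsu] using hT.param_unique _ _ _ _ h1 h2

/-- Past the last time `m` at which they agree, two geodesics from the same point
are joined through their branch point. -/
theorem IsRTree.dist_of_branch (hT : IsRTree T) (hf : IsSegParam p u f)
    (hg : IsSegParam p v g) {m s t : ℝ} (hm : 0 ≤ m) (hfg : f m = g m)
    (hmax : ∀ r ∈ Icc 0 (dist p u), r ∈ Icc 0 (dist p v) → f r = g r → r ≤ m)
    (hms : m < s) (hs : s ≤ dist p u) (hmt : m < t) (ht : t ≤ dist p v) :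
    dist (f s) (g t) = s + t - 2 * m := by
  have hα : ∀ q ∈ Icc (0 : ℝ) (1 / 2), s - 2 * q * (s - m) ∈ Icc m s := fun q hq =>
    ⟨by nlinarith [hq.2], by nlinarith [hq.1]⟩
  have hβ : ∀ q ∈ Icc (1 / 2 : ℝ) 1, m + (2 * q - 1) * (t - m) ∈ Icc m t := fun q hq =>
    ⟨by nlinarith [hq.1], by nlinarith [hq.2]⟩
  have hu : Icc m s ⊆ Icc 0 (dist p u) := Icc_subset_Icc hm hs
  have hv : Icc m t ⊆ Icc 0 (dist p v) := Icc_subset_Icc hm ht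
  let h : ℝ → T := fun q =>
    if q ≤ 1 / 2 then f (s - 2 * q * (s - m)) else g (m + (2 * q - 1) * (t - m))
  have hl : ∀ q : ℝ, q ≤ 1 / 2 → h q = f (s - 2 * q * (s - m)) := fun q hq => if_pos hq
  have hr : ∀ q : ℝ, ¬ q ≤ 1 / 2 → h q = g (m + (2 * q - 1) * (t - m)) := fun q hq => if_neg hq
  have hhalf : h (1 / 2) = f m := by
    rw [hl _ le_rfl]
    congr 1
    ring
  have hcont : ContinuousOn h (Icc 0 1) := by
    rw [← Icc_union_Icc_eq_Icc (show (0 : ℝ) ≤ 1 / 2 by norm_num) (by norm_num)]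
    refine ContinuousOn.union_of_isClosed ?_ ?_ isClosed_Icc isClosed_Icc
    · refine ContinuousOn.congr (f := fun q => f (s - 2 * q * (s - m))) ?_ fun q hq => hl q hq.2
      exact hf.continuousOn.comp (by fun_prop) fun q hq => hu (hα q hq)
    · refine ContinuousOn.congr (f := fun q => g (m + (2 * q - 1) * (t - m))) ?_ fun q hq => ?_
      · exact hg.continuousOn.comp (by fun_prop) fun q hq => hv (hβ q hq)
      · rcases hq.1.eq_or_lt with rfl | hlt
        · rw [hhalf, hfg]
          norm_num
        · exact hr q hlt.not_ge
  have hcross : ∀ a ∈ Icc (0 : ℝ) 1, ∀ b ∈ Icc (0 : ℝ) 1, a ≤ 1 / 2 → ¬ b ≤ 1 / 2 →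
      h a ≠ h b := by
    intro a ha b hb ha2 hb2 hab
    rw [hl a ha2, hr b hb2] at hab
    have h1 := hu (hα a ⟨ha.1, ha2⟩)
    have h2 := hv (hβ b ⟨(not_le.1 hb2).le, hb.2⟩)
    have h3 := hf.dist_left h1
    rw [hab, hg.dist_left h2] at h3
    rw [← h3] at hab h1
    have h4 := hmax _ h1 h2 hab
    nlinarith [not_le.1 hb2]
  have hinj : InjOn h (Icc 0 1) := by
    intro a ha b hb hab
    by_cases ha2 : a ≤ 1 / 2 <;> by_cases hb2 : b ≤ 1 / 2
    · rw [hl a ha2, hl b hb2] at hab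
      have h1 := hf.dist_left (hu (hα a ⟨ha.1, ha2⟩))
      rw [hab, hf.dist_left (hu (hα b ⟨hb.1, hb2⟩))] at h1
      exact mul_right_cancel₀ (sub_pos.2 hms).ne' (by linarith)
    · exact (hcross a ha b hb ha2 hb2 hab).elim
    · exact (hcross b hb a ha hb2 ha2 hab.symm).elim
    · rw [hr a ha2, hr b hb2] at hab
      have h1 := hg.dist_left (hv (hβ a ⟨(not_le.1 ha2).le, ha.2⟩))
      rw [hab, hg.dist_left (hv (hβ b ⟨(not_le.1 hb2).le, hb.2⟩))] at h1
      exact mul_right_cancel₀ (sub_pos.2 hmt).ne' (by linarith)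
  have himg := hT.arc_eq_seg (f s) (g t) h hcont hinj
    (by rw [hl 0 (by norm_num)]; simp) (by rw [hr 1 (by norm_num)]; congr 1; ring)
  have hmem : f m ∈ rSeg (f s) (g t) := by
    rw [← himg]
    exact ⟨1 / 2, by norm_num, hhalf⟩
  rw [← dist_add_dist_of_mem_rSeg hmem,
    hf.2.2 s (hu ⟨hms.le, le_rfl⟩) m (hu ⟨le_rfl, hms.le⟩), hfg,
    hg.2.2 m (hv ⟨le_rfl, hmt.le⟩) t (hv ⟨hmt.le, le_rfl⟩),
    abs_of_pos (sub_pos.2 hms), abs_sub_comm, abs_of_pos (sub_pos.2 hmt)]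
  ring

/-- In an `ℝ`-tree, the distance between points on two geodesics from `p` to `u` and `v`
is determined by the times and the Gromov product of `u` and `v` based at `p`. -/
theorem IsRTree.dist_eq_gromov (hT : IsRTree T) (hf : IsSegParam p u f)
    (hg : IsSegParam p v g) {s t : ℝ} (hs : s ∈ Icc 0 (dist p u)) (ht : t ∈ Icc 0 (dist p v)) :
    dist (f s) (g t) =
      s + t - 2 * min (min s t) ((dist p u + dist p v - dist u v) / 2) := by
  obtain ⟨m, ⟨⟨hmu, hmv⟩, hfg⟩, hmax⟩ : ∃ m, IsGreatest
      {r | r ∈ Icc 0 (dist p u) ∩ Icc 0 (dist p v) ∧ f r = g r} m := by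
    refine IsCompact.exists_isGreatest ?_ ⟨0, ?_⟩
    · have hc : IsClosed (Icc 0 (dist p u) ∩ Icc 0 (dist p v)) := isClosed_Icc.inter isClosed_Icc
      have hd : ContinuousOn (fun r => dist (f r) (g r))
          (Icc 0 (dist p u) ∩ Icc 0 (dist p v)) :=
        continuous_dist.comp_continuousOn
          ((hf.continuousOn.mono inter_subset_left).prodMk
            (hg.continuousOn.mono inter_subset_right))
      have := hd.preimage_isClosed_of_isClosed hc (isClosed_singleton (x := (0 : ℝ)))
      refine (isCompact_Icc (a := 0) (b := dist p u)).of_isClosed_subset ?_ fun r hr => hr.1.1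
      convert this using 1
      ext r
      simp
    · exact ⟨⟨⟨le_rfl, dist_nonneg⟩, ⟨le_rfl, dist_nonneg⟩⟩, by rw [hf.1, hg.1]⟩
  have heq := hT.eqOn_of_eq hf hg hmu hmv hfg
  have key : ∀ s ∈ Icc 0 (dist p u), ∀ t ∈ Icc 0 (dist p v),
      dist (f s) (g t) = s + t - 2 * min (min s t) m := by
    intro s hs t ht
    rcases le_or_gt (min s t) m with h | h
    · have habs : dist (f s) (g t) = |s - t| := by
        rcases le_total s t with hst | hst
        · rw [min_eq_left hst] at h
          rw [heq ⟨hs.1, h⟩]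
          exact hg.2.2 s ⟨hs.1, hst.trans ht.2⟩ t ht
        · rw [min_eq_right hst] at h
          rw [← heq ⟨ht.1, h⟩]
          exact hf.2.2 s hs t ⟨ht.1, hst.trans hs.2⟩
      rw [habs, min_eq_left h, ← max_sub_min_eq_abs', ← max_add_min s t]
      ring
    · obtain ⟨hms, hmt⟩ := lt_min_iff.1 h
      rw [min_eq_right h.le]
      exact hT.dist_of_branch hf hg hmu.1 hfg (fun r hru hrv hr => hmax ⟨⟨hru, hrv⟩, hr⟩)
        hms hs.2 hmt ht.2
  have hend := key _ ⟨dist_nonneg, le_rfl⟩ _ ⟨dist_nonneg, le_rfl⟩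
  rw [hf.2.1, hg.2.1, min_eq_right (le_min hmu.2 hmv.2)] at hend
  rw [key s hs t ht, hend]
  congr 3
  ring

end Segments

/-- Uniqueness of the cut-tree: an `ℝ`-tree containing a countable family of points
realizing a prescribed distance matrix `D` (a metric on `ℕ`, with `0` the root) and
spanned by the segments from the root to those points is unique up to a root- and
point-preserving isometry. -/
theorem rTree_spanned_unique {R R' : Type*} [MetricSpace R] [MetricSpace R']
    (hR : IsRTree R) (hR' : IsRTree R')
    (D : ℕ → ℕ → ℝ)
    (hDzero : ∀ i, D i i = 0) (hDsep : ∀ i j, D i j = 0 → i = j)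
    (hDsymm : ∀ i j, D i j = D j i) (hDtri : ∀ i j k, D i k ≤ D i j + D j k)
    (x : ℕ → R) (x' : ℕ → R')
    (hx : ∀ i j, dist (x i) (x j) = D i j)
    (hx' : ∀ i j, dist (x' i) (x' j) = D i j)
    (hspan : (⋃ i ∈ {i : ℕ | 1 ≤ i}, rSeg (x 0) (x i)) = univ)
    (hspan' : (⋃ i ∈ {i : ℕ | 1 ≤ i}, rSeg (x' 0) (x' i)) = univ) :
    ∃ φ : R ≃ᵢ R', ∀ i, φ (x i) = x' i := by
  choose f hf using fun i => hR.exists_param (x 0) (x i)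
  choose f' hf' using fun i => hR'.exists_param (x' 0) (x' i)
  have hlen : ∀ i, dist (x' 0) (x' i) = dist (x 0) (x i) := fun i => by rw [hx, hx']
  have hdist : ∀ i j, ∀ s ∈ Icc 0 (dist (x 0) (x i)), ∀ t ∈ Icc 0 (dist (x 0) (x j)),
      dist (f' i s) (f' j t) = dist (f i s) (f j t) := by
    intro i j s hs t ht
    rw [hR.dist_eq_gromov (hf i) (hf j) hs ht,
      hR'.dist_eq_gromov (hf' i) (hf' j) (by rwa [hlen]) (by rwa [hlen])]
    simp only [hx, hx']
  have hcover : ∀ y : R, ∃ i, ∃ s ∈ Icc 0 (dist (x 0) (x i)), f i s = y := by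
    intro y
    have hy : y ∈ ⋃ i ∈ {i : ℕ | 1 ≤ i}, rSeg (x 0) (x i) := hspan ▸ mem_univ y
    obtain ⟨i, -, g, hg, s, hs, rfl⟩ := mem_iUnion₂.1 hy
    exact ⟨i, s, hs, hR.param_unique _ _ _ _ (hf i) hg hs⟩
  have hcover' : ∀ y : R', ∃ i, ∃ s ∈ Icc 0 (dist (x 0) (x i)), f' i s = y := by
    intro y
    have hy : y ∈ ⋃ i ∈ {i : ℕ | 1 ≤ i}, rSeg (x' 0) (x' i) := hspan' ▸ mem_univ y
    obtain ⟨i, -, g, hg, s, hs, rfl⟩ := mem_iUnion₂.1 hy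
    exact ⟨i, s, hlen i ▸ hs, hR'.param_unique _ _ _ _ (hf' i) hg hs⟩
  choose k τ hτ hfτ using hcover
  have hφ : ∀ i, ∀ s ∈ Icc 0 (dist (x 0) (x i)), f' (k (f i s)) (τ (f i s)) = f' i s := by
    intro i s hs
    rw [← dist_eq_zero, hdist _ _ _ (hτ _) _ hs, hfτ, dist_self]
  have hiso : Isometry fun y => f' (k y) (τ y) := Isometry.of_dist_eq fun y z => by
    rw [hdist _ _ _ (hτ y) _ (hτ z), hfτ, hfτ]
  have hsurj : Function.Surjective fun y => f' (k y) (τ y) := fun z => by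
    obtain ⟨i, s, hs, rfl⟩ := hcover' z
    exact ⟨f i s, hφ i s hs⟩
  refine ⟨⟨Equiv.ofBijective _ ⟨hiso.injective, hsurj⟩, hiso⟩, fun i => ?_⟩
  have h := hφ i _ ⟨dist_nonneg, le_rfl⟩
  rw [(hf i).2.1, ← hlen, (hf' i).2.1] at h
  exact h
end

section
/- Fix β ∈ [1/2, 1). Let μ be a Borel probability measure on [0,∞) with mean ∫ x dμ(x) = 2Γ(β+1)/Γ(2β+1). Then the pushforward of the product measure μ ⊗ μ ⊗ ν_D under the map (m₁, m₂, (x₁,x₂)) ↦ x₁^β·m₁ + x₂^β·m₂ equals μ if and only if, for every integer p ≥ 0, ∫ x^p dμ(x) = Γ(β+1)·Γ(p+2)/Γ((p+1)β+1); that is, if and only if μ is the size-biased Mittag-Leffler distribution with parameter β. -/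
open MeasureTheory
open scoped Classical

/-- The open triangle `S = {(x₁,x₂) : x₁ > 0, x₂ > 0, x₁ + x₂ < 1}`. -/
def dirichletSupport : Set (ℝ × ℝ) := {q : ℝ × ℝ | 0 < q.1 ∧ 0 < q.2 ∧ q.1 + q.2 < 1}

/-- The density of the Dirichlet(β, β, 1−β) measure with respect to Lebesgue
measure on `ℝ²`: proportional to `x₁^(β−1) x₂^(β−1) (1−x₁−x₂)^(−β)` on the open
triangle `S`, and `0` outside. -/
noncomputable def dirichletDensity (β : ℝ) (q : ℝ × ℝ) : ℝ :=
  if q ∈ dirichletSupport then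
    Real.Gamma (β + 1) / (Real.Gamma β ^ 2 * Real.Gamma (1 - β)) *
      (q.1 ^ (β - 1) * q.2 ^ (β - 1) * (1 - q.1 - q.2) ^ (-β))
  else 0

/-- The Dirichlet(β, β, 1−β) measure on `ℝ²`. -/
noncomputable def dirichletMeasure (β : ℝ) : Measure (ℝ × ℝ) :=
  volume.withDensity fun q => ENNReal.ofReal (dirichletDensity β q)

open ProbabilityTheory Filter Topology

theorem lintegral_Ioo_zero_one_beta {s u : ℝ} (hs : 0 < s) (hu : 0 < u) :
    ∫⁻ x in Set.Ioo (0 : ℝ) 1, ENNReal.ofReal (x ^ (s - 1) * (1 - x) ^ (u - 1)) =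
      ENNReal.ofReal (beta s u) := by
  have hb := beta_pos hs hu
  have h := lintegral_betaPDF_eq_one hs hu
  rw [lintegral_betaPDF] at h
  have h2 : ∀ x : ℝ, ENNReal.ofReal (1 / beta s u * x ^ (s - 1) * (1 - x) ^ (u - 1)) =
      ENNReal.ofReal (1 / beta s u) * ENNReal.ofReal (x ^ (s - 1) * (1 - x) ^ (u - 1)) := by
    intro x
    rw [mul_assoc, ENNReal.ofReal_mul (by positivity)]
  simp_rw [h2] at h
  rw [lintegral_const_mul _ (by fun_prop)] at h
  calc _ = ENNReal.ofReal (beta s u) * (ENNReal.ofReal (1 / beta s u) * _) := by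
        rw [← mul_assoc, ← ENNReal.ofReal_mul hb.le, mul_one_div_cancel hb.ne',
          ENNReal.ofReal_one, one_mul]
    _ = _ := by rw [h, mul_one]

theorem lintegral_Ioo_zero_beta {s u c : ℝ} (hs : 0 < s) (hu : 0 < u) (hc : 0 < c) :
    ∫⁻ y in Set.Ioo (0 : ℝ) c, ENNReal.ofReal (y ^ (s - 1) * (c - y) ^ (u - 1)) =
      ENNReal.ofReal (c ^ (s + u - 1) * beta s u) := by
  rw [← lintegral_indicator measurableSet_Ioo, ← Real.smul_map_volume_mul_left hc.ne',
    lintegral_smul_measure, lintegral_map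
      (Measurable.indicator (by fun_prop) measurableSet_Ioo) (by fun_prop),
    ENNReal.ofReal_mul (by positivity), ← lintegral_Ioo_zero_one_beta hs hu,
    ← lintegral_indicator measurableSet_Ioo, smul_eq_mul,
    ← lintegral_const_mul' _ _ ENNReal.ofReal_ne_top,
    ← lintegral_const_mul' _ _ ENNReal.ofReal_ne_top]
  congr 1 with x
  have hmem : c * x ∈ Set.Ioo 0 c ↔ x ∈ Set.Ioo (0 : ℝ) 1 := by
    simp only [Set.mem_Ioo, hc, mul_pos_iff_of_pos_left, mul_lt_iff_lt_one_right]
  by_cases hx : x ∈ Set.Ioo (0 : ℝ) 1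
  · rw [Set.indicator_of_mem (hmem.2 hx), Set.indicator_of_mem hx, abs_of_pos hc,
      ← ENNReal.ofReal_mul hc.le, ← ENNReal.ofReal_mul (by positivity)]
    congr 1
    rw [show c - c * x = c * (1 - x) by ring, Real.mul_rpow hc.le hx.1.le,
      Real.mul_rpow hc.le (by linarith [hx.2]),
      show s + u - 1 = 1 + (s - 1) + (u - 1) by ring, Real.rpow_add hc, Real.rpow_add hc,
      Real.rpow_one]
    ring
  · rw [Set.indicator_of_notMem (hmem.not.2 hx), Set.indicator_of_notMem hx]
    simp

theorem measurableSet_dirichletSupport : MeasurableSet dirichletSupport :=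
  (measurableSet_lt measurable_const measurable_fst).inter
    ((measurableSet_lt measurable_const measurable_snd).inter
      (measurableSet_lt (measurable_fst.add measurable_snd) measurable_const))

theorem lintegral_dirichletSupport {s t u : ℝ} (hs : 0 < s) (ht : 0 < t) (hu : 0 < u) :
    ∫⁻ q in dirichletSupport,
        ENNReal.ofReal (q.1 ^ (s - 1) * q.2 ^ (t - 1) * (1 - q.1 - q.2) ^ (u - 1)) =
      ENNReal.ofReal (Real.Gamma s * Real.Gamma t * Real.Gamma u / Real.Gamma (s + t + u)) := by
  have hmeas : Measurable (dirichletSupport.indicator fun q : ℝ × ℝ =>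
      ENNReal.ofReal (q.1 ^ (s - 1) * q.2 ^ (t - 1) * (1 - q.1 - q.2) ^ (u - 1))) :=
    Measurable.indicator (by fun_prop) measurableSet_dirichletSupport
  have hinner : ∀ x : ℝ, ∫⁻ y, dirichletSupport.indicator (fun q : ℝ × ℝ =>
      ENNReal.ofReal (q.1 ^ (s - 1) * q.2 ^ (t - 1) * (1 - q.1 - q.2) ^ (u - 1))) (x, y) =
      (Set.Ioo (0 : ℝ) 1).indicator (fun x => ENNReal.ofReal (beta t u) *
        ENNReal.ofReal (x ^ (s - 1) * (1 - x) ^ (t + u - 1))) x := by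
    intro x
    by_cases hx : x ∈ Set.Ioo (0 : ℝ) 1
    · have hx1 : 0 < 1 - x := by linarith [hx.2]
      have hx0 := hx.1
      have hb := beta_pos ht hu
      rw [Set.indicator_of_mem hx, ← ENNReal.ofReal_mul hb.le,
        show beta t u * (x ^ (s - 1) * (1 - x) ^ (t + u - 1)) =
          x ^ (s - 1) * ((1 - x) ^ (t + u - 1) * beta t u) by ring,
        ENNReal.ofReal_mul (by positivity), ← lintegral_Ioo_zero_beta ht hu hx1,
        ← lintegral_indicator measurableSet_Ioo,
        ← lintegral_const_mul _ (Measurable.indicator (by fun_prop) measurableSet_Ioo)]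
      congr 1 with y
      by_cases hy : y ∈ Set.Ioo 0 (1 - x)
      · have : (x, y) ∈ dirichletSupport := ⟨hx.1, hy.1, by simp only; linarith [hy.2]⟩
        rw [Set.indicator_of_mem this, Set.indicator_of_mem hy,
          ← ENNReal.ofReal_mul (by positivity), mul_assoc]
      · have : (x, y) ∉ dirichletSupport := fun h => hy ⟨h.2.1, by linarith [h.2.2]⟩
        rw [Set.indicator_of_notMem this, Set.indicator_of_notMem hy, mul_zero]
    · rw [Set.indicator_of_notMem hx]
      have : ∀ y, (x, y) ∉ dirichletSupport := fun y h =>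
        hx ⟨h.1, by linarith [h.2.1, h.2.2]⟩
      simp [this]
  rw [← lintegral_indicator measurableSet_dirichletSupport, Measure.volume_eq_prod,
    lintegral_prod _ hmeas.aemeasurable]
  simp_rw [hinner]
  rw [lintegral_indicator measurableSet_Ioo, lintegral_const_mul _ (by fun_prop),
    lintegral_Ioo_zero_one_beta hs (add_pos ht hu), ← ENNReal.ofReal_mul (beta_pos ht hu).le]
  congr 1
  have := (Real.Gamma_pos_of_pos (add_pos ht hu)).ne'
  rw [beta, beta, ← add_assoc]
  field_simp

theorem dirichletMeasure_eq (β : ℝ) : dirichletMeasure β =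
    (volume.restrict dirichletSupport).withDensity fun q => ENNReal.ofReal
      (Real.Gamma (β + 1) / (Real.Gamma β ^ 2 * Real.Gamma (1 - β)) *
      (q.1 ^ (β - 1) * q.2 ^ (β - 1) * (1 - q.1 - q.2) ^ (-β))) := by
  rw [← withDensity_indicator measurableSet_dirichletSupport, dirichletMeasure]
  congr 1 with q
  by_cases hq : q ∈ dirichletSupport <;> simp [dirichletDensity, hq]

theorem ae_mem_dirichletSupport (β : ℝ) : ∀ᵐ q ∂dirichletMeasure β, q ∈ dirichletSupport := by
  rw [dirichletMeasure_eq]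
  exact (withDensity_absolutelyContinuous _ _).ae_le
    (ae_restrict_mem measurableSet_dirichletSupport)

theorem lintegral_dirichletMeasure_pow {β : ℝ} (hβ0 : 0 < β) (hβ1 : β < 1) (k l : ℕ) :
    ∫⁻ q, ENNReal.ofReal ((q.1 ^ β) ^ k * (q.2 ^ β) ^ l) ∂dirichletMeasure β =
      ENNReal.ofReal (Real.Gamma (β + 1) * Real.Gamma ((k + 1) * β) * Real.Gamma ((l + 1) * β) /
        (Real.Gamma β ^ 2 * Real.Gamma ((k + l + 1) * β + 1))) := by
  have hg0 := Real.Gamma_pos_of_pos hβ0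
  have hg1 : 0 < Real.Gamma (β + 1) := Real.Gamma_pos_of_pos (by linarith)
  have hg2 : 0 < Real.Gamma (1 - β) := Real.Gamma_pos_of_pos (by linarith)
  have h := lintegral_dirichletSupport (s := (k + 1) * β) (t := (l + 1) * β) (u := 1 - β)
    (by positivity) (by positivity) (by linarith)
  rw [dirichletMeasure_eq, lintegral_withDensity_eq_lintegral_mul _ (by fun_prop) (by fun_prop)]
  have hc : Real.Gamma (β + 1) * Real.Gamma ((k + 1) * β) * Real.Gamma ((l + 1) * β) /
        (Real.Gamma β ^ 2 * Real.Gamma ((k + l + 1) * β + 1)) =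
      Real.Gamma (β + 1) / (Real.Gamma β ^ 2 * Real.Gamma (1 - β)) *
      (Real.Gamma ((k + 1) * β) * Real.Gamma ((l + 1) * β) * Real.Gamma (1 - β) /
        Real.Gamma ((k + 1) * β + (l + 1) * β + (1 - β))) := by
    rw [show ((k : ℝ) + 1) * β + (l + 1) * β + (1 - β) = (k + l + 1) * β + 1 by ring]
    field_simp
  rw [hc, ENNReal.ofReal_mul (by positivity), ← h, ← lintegral_const_mul _ (by fun_prop)]
  refine setLIntegral_congr_fun measurableSet_dirichletSupport fun q hq => ?_
  obtain ⟨h1, h2, h3⟩ := hq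
  have h4 : 0 < 1 - q.1 - q.2 := by linarith
  simp only [Pi.mul_apply]
  rw [← ENNReal.ofReal_mul (by positivity), ← ENNReal.ofReal_mul (by positivity)]
  congr 1
  rw [show ((k : ℝ) + 1) * β - 1 = (β - 1) + β * k by ring,
    show ((l : ℝ) + 1) * β - 1 = (β - 1) + β * l by ring, show (1 - β) - 1 = -β by ring,
    Real.rpow_add h1, Real.rpow_add h2, Real.rpow_mul h1.le, Real.rpow_mul h2.le,
    Real.rpow_natCast, Real.rpow_natCast]
  ring

theorem integrable_dirichletMeasure_pow {β : ℝ} (hβ0 : 0 < β) (hβ1 : β < 1) (k l : ℕ) :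
    Integrable (fun q : ℝ × ℝ => (q.1 ^ β) ^ k * (q.2 ^ β) ^ l) (dirichletMeasure β) := by
  refine ⟨by fun_prop, ?_⟩
  rw [hasFiniteIntegral_iff_ofReal, lintegral_dirichletMeasure_pow hβ0 hβ1]
  · exact ENNReal.ofReal_lt_top
  · filter_upwards [ae_mem_dirichletSupport β] with q ⟨h1, h2, _⟩
    simp only [Pi.zero_apply]
    positivity

theorem integral_dirichletMeasure_pow {β : ℝ} (hβ0 : 0 < β) (hβ1 : β < 1) (k l : ℕ) :
    ∫ q, (q.1 ^ β) ^ k * (q.2 ^ β) ^ l ∂dirichletMeasure β =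
      Real.Gamma (β + 1) * Real.Gamma ((k + 1) * β) * Real.Gamma ((l + 1) * β) /
        (Real.Gamma β ^ 2 * Real.Gamma ((k + l + 1) * β + 1)) := by
  rw [integral_eq_lintegral_of_nonneg_ae, lintegral_dirichletMeasure_pow hβ0 hβ1,
    ENNReal.toReal_ofReal]
  · have := Real.Gamma_pos_of_pos hβ0
    have := Real.Gamma_pos_of_pos (show 0 < β + 1 by linarith)
    have := Real.Gamma_pos_of_pos (show 0 < (k + 1) * β by positivity)
    have := Real.Gamma_pos_of_pos (show 0 < (l + 1) * β by positivity)
    have := Real.Gamma_pos_of_pos (show 0 < (k + l + 1) * β + 1 by positivity)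
    positivity
  · filter_upwards [ae_mem_dirichletSupport β] with q ⟨h1, h2, _⟩
    simp only [Pi.zero_apply]
    positivity
  · fun_prop

theorem integral_dirichletMeasure_fst_pow {β : ℝ} (hβ0 : 0 < β) (hβ1 : β < 1) (k : ℕ) :
    ∫ q, (q.1 ^ β) ^ k ∂dirichletMeasure β = 1 / (k + 1) := by
  have h := integral_dirichletMeasure_pow hβ0 hβ1 k 0
  simp only [pow_zero, mul_one, Nat.cast_zero, zero_add, add_zero, one_mul] at h
  have := Real.Gamma_pos_of_pos hβ0
  have := Real.Gamma_pos_of_pos (show 0 < (k + 1) * β by positivity)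
  rw [h, Real.Gamma_add_one hβ0.ne', Real.Gamma_add_one (by positivity)]
  field_simp

theorem integral_dirichletMeasure_snd_pow {β : ℝ} (hβ0 : 0 < β) (hβ1 : β < 1) (k : ℕ) :
    ∫ q, (q.2 ^ β) ^ k ∂dirichletMeasure β = 1 / (k + 1) := by
  have h := integral_dirichletMeasure_pow hβ0 hβ1 0 k
  simp only [pow_zero, one_mul, Nat.cast_zero, zero_add] at h
  have := Real.Gamma_pos_of_pos hβ0
  have := Real.Gamma_pos_of_pos (show 0 < (k + 1) * β by positivity)
  rw [h, Real.Gamma_add_one hβ0.ne', Real.Gamma_add_one (by positivity)]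
  field_simp

theorem isProbabilityMeasure_dirichletMeasure {β : ℝ} (hβ0 : 0 < β) (hβ1 : β < 1) :
    IsProbabilityMeasure (dirichletMeasure β) := by
  constructor
  have h := lintegral_dirichletMeasure_pow hβ0 hβ1 0 0
  have hg0 := Real.Gamma_pos_of_pos hβ0
  have hg1 : 0 < Real.Gamma (β + 1) := Real.Gamma_pos_of_pos (by linarith)
  have hc : Real.Gamma (β + 1) * Real.Gamma β * Real.Gamma β /
      (Real.Gamma β ^ 2 * Real.Gamma (β + 1)) = 1 := by field_simp
  simpa [hc] using h

/-- The map `(m₁, m₂, (x₁, x₂)) ↦ x₁^β m₁ + x₂^β m₂`. -/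
noncomputable def smoothingMap (β : ℝ) (q : ℝ × ℝ × (ℝ × ℝ)) : ℝ :=
  q.2.2.1 ^ β * q.1 + q.2.2.2 ^ β * q.2.1

@[fun_prop]
theorem measurable_smoothingMap (β : ℝ) : Measurable (smoothingMap β) := by
  unfold smoothingMap
  fun_prop

theorem integrable_smoothing_monomial {β : ℝ} (hβ0 : 0 < β) (hβ1 : β < 1) {μ : Measure ℝ}
    [SFinite μ] {k l : ℕ} (hk : Integrable (fun x => x ^ k) μ)
    (hl : Integrable (fun x => x ^ l) μ) :
    Integrable (fun q : ℝ × ℝ × (ℝ × ℝ) => (q.2.2.1 ^ β * q.1) ^ k * (q.2.2.2 ^ β * q.2.1) ^ l)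
      (μ.prod (μ.prod (dirichletMeasure β))) := by
  have : SFinite (dirichletMeasure β) :=
    have := isProbabilityMeasure_dirichletMeasure hβ0 hβ1
    inferInstance
  refine (hk.mul_prod (hl.mul_prod (integrable_dirichletMeasure_pow hβ0 hβ1 k l))).congr
    (ae_of_all _ fun q => ?_)
  simp only [mul_pow]
  ring

theorem integral_smoothing_monomial {β : ℝ} (hβ0 : 0 < β) (hβ1 : β < 1) {μ : Measure ℝ}
    [SFinite μ] (k l : ℕ) :
    ∫ q, (q.2.2.1 ^ β * q.1) ^ k * (q.2.2.2 ^ β * q.2.1) ^ l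
      ∂(μ.prod (μ.prod (dirichletMeasure β))) =
      (∫ x, x ^ k ∂μ) * ((∫ x, x ^ l ∂μ) *
        (Real.Gamma (β + 1) * Real.Gamma ((k + 1) * β) * Real.Gamma ((l + 1) * β) /
          (Real.Gamma β ^ 2 * Real.Gamma ((k + l + 1) * β + 1)))) := by
  have : SFinite (dirichletMeasure β) :=
    have := isProbabilityMeasure_dirichletMeasure hβ0 hβ1
    inferInstance
  rw [← integral_dirichletMeasure_pow hβ0 hβ1 k l,
    ← integral_prod_mul (fun x : ℝ => x ^ l), ← integral_prod_mul (fun x : ℝ => x ^ k)]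
  congr 1 with q
  simp only [mul_pow]
  ring

theorem integral_smoothingMap_pow {β : ℝ} (hβ0 : 0 < β) (hβ1 : β < 1) {μ : Measure ℝ}
    [SFinite μ] {p : ℕ} (h : ∀ k ≤ p, Integrable (fun x => x ^ k) μ) :
    ∫ q, smoothingMap β q ^ p ∂(μ.prod (μ.prod (dirichletMeasure β))) =
      ∑ k ∈ Finset.range (p + 1), (∫ x, x ^ k ∂μ) * (∫ x, x ^ (p - k) ∂μ) * p.choose k *
        (Real.Gamma (β + 1) * Real.Gamma ((k + 1) * β) * Real.Gamma (((p - k : ℕ) + 1) * β) /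
          (Real.Gamma β ^ 2 * Real.Gamma ((p + 1) * β + 1))) := by
  simp only [smoothingMap, add_pow]
  rw [integral_finsetSum]
  · refine Finset.sum_congr rfl fun k hk => ?_
    have hk := Finset.mem_range.1 hk
    have hkp : (k : ℝ) + (p - k : ℕ) = p := by
      rw [← Nat.cast_add, Nat.add_sub_cancel' (by omega)]
    rw [integral_mul_const, integral_smoothing_monomial hβ0 hβ1, hkp]
    ring
  · intro k hk
    have hk := Finset.mem_range.1 hk
    exact (integrable_smoothing_monomial hβ0 hβ1 (h k (by omega))
      (h (p - k) (by omega))).mul_const _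

theorem add_pow_mul_min_le {x y N : ℝ} (hx : 0 ≤ x) (hy : 0 ≤ y) (hN : 0 ≤ N) (n : ℕ) :
    (x + y) ^ (n + 1) * min (x + y) N ≤ x ^ (n + 1) * min x N + y ^ (n + 1) * min y N +
      ((x + y) ^ (n + 2) - x ^ (n + 2) - y ^ (n + 2)) := by
  have h1 : min (x + y) N ≤ min x N + min y N := by
    rcases le_total x N with h | h <;> rcases le_total y N with h' | h' <;>
      simp only [h, h', min_eq_left, min_eq_right] <;>
      [exact min_le_left _ _; skip; skip; skip] <;>
      exact (min_le_right _ _).trans (by linarith)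
  have hx1 : x ^ (n + 1) ≤ (x + y) ^ (n + 1) := by gcongr; linarith
  have hy1 : y ^ (n + 1) ≤ (x + y) ^ (n + 1) := by gcongr; linarith
  have h2 := mul_le_mul_of_nonneg_left h1 (show 0 ≤ (x + y) ^ (n + 1) by positivity)
  have h3 := mul_le_mul_of_nonneg_left (min_le_left x N) (sub_nonneg.2 hx1)
  have h4 := mul_le_mul_of_nonneg_left (min_le_left y N) (sub_nonneg.2 hy1)
  have h5 : (x + y) ^ (n + 2) - x ^ (n + 2) - y ^ (n + 2) =
      ((x + y) ^ (n + 1) - x ^ (n + 1)) * x + ((x + y) ^ (n + 1) - y ^ (n + 1)) * y := by ring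
  linarith

theorem smoothing_remainder_eq (x y : ℝ) (n : ℕ) :
    (x + y) ^ (n + 2) - x ^ (n + 2) - y ^ (n + 2) =
      ∑ k ∈ Finset.range (n + 1), x ^ (k + 1) * y ^ (n + 1 - k) * (n + 2).choose (k + 1) := by
  rw [add_pow, Finset.sum_range_succ, Finset.sum_range_succ']
  simp

/-- The one-variable building block of the truncation argument: if the truncated moment
`G N = ∫ x^(n+1) min(x, N) dμ` is at most `ε N + K`, then the contribution of `a · x`, for an
independent `a > 0` with moments `1 / (k + 1)`, is at most `ε N / (n + 2) + K / (n + 3)`. -/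
theorem integral_scaled_truncation_le {Ω : Type*} [MeasurableSpace Ω] {D : Measure Ω}
    [IsProbabilityMeasure D] {a : Ω → ℝ} (ha : Measurable a) (ha0 : ∀ᵐ ω ∂D, 0 < a ω)
    (hai : ∀ k : ℕ, Integrable (fun ω => a ω ^ k) D)
    (ham : ∀ k : ℕ, ∫ ω, a ω ^ k ∂D = 1 / (k + 1))
    {μ : Measure ℝ} [IsProbabilityMeasure μ] (hμ : ∀ᵐ x ∂μ, 0 ≤ x) {n : ℕ}
    (hint : Integrable (fun x => x ^ (n + 1)) μ) {N : ℝ} (hN : 0 < N) :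
    Integrable (fun q : ℝ × Ω => (a q.2 * q.1) ^ (n + 1) * min (a q.2 * q.1) N) (μ.prod D) ∧
    ∀ ε K : ℝ, (∀ N > 0, ∫ x, x ^ (n + 1) * min x N ∂μ ≤ ε * N + K) →
      ∫ q, (a q.2 * q.1) ^ (n + 1) * min (a q.2 * q.1) N ∂(μ.prod D) ≤
        ε * N / (n + 2) + K / (n + 3) := by
  have hae : ∀ᵐ q ∂(μ.prod D), 0 ≤ q.1 ∧ 0 < a q.2 :=
    (Measure.quasiMeasurePreserving_fst.ae hμ).and (Measure.quasiMeasurePreserving_snd.ae ha0)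
  have hI : Integrable (fun q : ℝ × Ω => (a q.2 * q.1) ^ (n + 1) * min (a q.2 * q.1) N)
      (μ.prod D) := by
    refine Integrable.mono' ((hint.mul_prod (hai (n + 1))).mul_const N)
      (Measurable.aestronglyMeasurable (by fun_prop)) ?_
    filter_upwards [hae] with q ⟨h1, h2⟩
    have h3 : 0 ≤ a q.2 * q.1 := by positivity
    rw [Real.norm_of_nonneg (mul_nonneg (by positivity) (le_min h3 hN.le)), mul_pow,
      mul_comm (a q.2 ^ (n + 1))]
    gcongr
    exact min_le_right _ _
  refine ⟨hI, fun ε K hK => ?_⟩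
  rw [integral_prod_symm _ hI]
  have hb : ∀ᵐ ω ∂D, ∫ x, (a ω * x) ^ (n + 1) * min (a ω * x) N ∂μ ≤
      ε * N * a ω ^ (n + 1) + K * a ω ^ (n + 2) := by
    filter_upwards [ha0] with ω hω
    have h1 : ∀ x, (a ω * x) ^ (n + 1) * min (a ω * x) N =
        a ω ^ (n + 2) * (x ^ (n + 1) * min x (N / a ω)) := by
      intro x
      have : min (a ω * x) N = a ω * min x (N / a ω) := by
        rw [mul_min_of_nonneg _ _ hω.le, mul_div_cancel₀ _ hω.ne']
      rw [this]
      ring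
    simp_rw [h1]
    rw [integral_const_mul]
    calc _ ≤ a ω ^ (n + 2) * (ε * (N / a ω) + K) := by
          gcongr
          exact hK _ (by positivity)
      _ = _ := by field_simp; ring
  calc _ ≤ ∫ ω, ε * N * a ω ^ (n + 1) + K * a ω ^ (n + 2) ∂D :=
        integral_mono_ae hI.integral_prod_right
          (((hai _).const_mul _).add ((hai _).const_mul _)) hb
    _ = _ := by
        rw [integral_add ((hai _).const_mul _) ((hai _).const_mul _), integral_const_mul,
          integral_const_mul, ham, ham]
        push_cast
        ring

theorem exists_truncated_moment_le {μ : Measure ℝ} [IsProbabilityMeasure μ]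
    (hμ : ∀ᵐ x ∂μ, 0 ≤ x) {n : ℕ} (hint : Integrable (fun x => x ^ (n + 1)) μ) {ε : ℝ}
    (hε : 0 < ε) :
    ∃ K : ℝ, 0 ≤ K ∧ ∀ N > 0, ∫ x, x ^ (n + 1) * min x N ∂μ ≤ ε * N + K := by
  have ht : Tendsto (fun R : ℕ => ∫ x, (Set.Ioi (R : ℝ)).indicator (fun x => x ^ (n + 1)) x ∂μ)
      atTop (𝓝 (∫ _, (0 : ℝ) ∂μ)) := by
    refine tendsto_integral_of_dominated_convergence (fun x => ‖x ^ (n + 1)‖)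
      (fun R => (Measurable.indicator (by fun_prop) measurableSet_Ioi).aestronglyMeasurable)
      hint.norm (fun R => ae_of_all _ fun x => norm_indicator_le_norm_self _ _)
      (ae_of_all _ fun x => ?_)
    obtain ⟨R₀, hR₀⟩ := exists_nat_ge x
    refine tendsto_const_nhds.congr' ?_
    filter_upwards [eventually_ge_atTop R₀] with R hR
    rw [Set.indicator_of_notMem]
    simp only [Set.mem_Ioi, not_lt]
    exact hR₀.trans (by exact_mod_cast hR)
  rw [integral_zero] at ht
  obtain ⟨R, hR⟩ := (ht.eventually_lt_const hε).exists
  refine ⟨(R : ℝ) ^ (n + 2), by positivity, fun N hN => ?_⟩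
  have hi : Integrable ((Set.Ioi (R : ℝ)).indicator (fun x => x ^ (n + 1))) μ :=
    hint.indicator measurableSet_Ioi
  calc _ ≤ ∫ x, (Set.Ioi (R : ℝ)).indicator (fun x => x ^ (n + 1)) x * N +
          (R : ℝ) ^ (n + 2) ∂μ := by
        refine integral_mono_of_nonneg ?_ ((hi.mul_const _).add (integrable_const _)) ?_
        · filter_upwards [hμ] with x hx
          exact mul_nonneg (by positivity) (le_min hx hN.le)
        · filter_upwards [hμ] with x hx
          by_cases hxR : x ∈ Set.Ioi (R : ℝ)
          · simp only [Set.indicator_of_mem hxR]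
            have := mul_le_mul_of_nonneg_left (min_le_right x N)
              (show 0 ≤ x ^ (n + 1) by positivity)
            have : (0 : ℝ) ≤ (R : ℝ) ^ (n + 2) := by positivity
            linarith
          · simp only [Set.indicator_of_notMem hxR, zero_mul, zero_add]
            have hxR : x ≤ R := not_lt.1 hxR
            calc x ^ (n + 1) * min x N ≤ x ^ (n + 1) * x := by gcongr; exact min_le_left _ _
              _ = x ^ (n + 2) := by ring
              _ ≤ _ := by gcongr
    _ = (∫ x, (Set.Ioi (R : ℝ)).indicator (fun x => x ^ (n + 1)) x ∂μ) * N + R ^ (n + 2) := by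
        rw [integral_add (hi.mul_const _) (integrable_const _), integral_mul_const]
        simp
    _ ≤ _ := by gcongr

theorem integrable_pow_of_truncated_moment_le {μ : Measure ℝ} [IsProbabilityMeasure μ]
    (hμ : ∀ᵐ x ∂μ, 0 ≤ x) {n : ℕ} (hint : Integrable (fun x => x ^ (n + 1)) μ) {C : ℝ}
    (hC : ∀ N > 0, ∫ x, x ^ (n + 1) * min x N ∂μ ≤ C) :
    Integrable (fun x => x ^ (n + 2)) μ := by
  have hnn : ∀ N : ℝ, 0 ≤ N → 0 ≤ᵐ[μ] fun x => x ^ (n + 1) * min x N := by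
    intro N hN
    filter_upwards [hμ] with x hx
    exact mul_nonneg (by positivity) (le_min hx hN)
  have hI : ∀ N : ℝ, 0 ≤ N → Integrable (fun x => x ^ (n + 1) * min x N) μ := by
    intro N hN
    refine Integrable.mono' (hint.mul_const N) (Measurable.aestronglyMeasurable (by fun_prop)) ?_
    filter_upwards [hμ] with x hx
    rw [Real.norm_of_nonneg (mul_nonneg (by positivity) (le_min hx hN))]
    gcongr
    exact min_le_right _ _
  refine ⟨by fun_prop, ?_⟩
  rw [hasFiniteIntegral_iff_ofReal (by
    filter_upwards [hμ] with x hx; simp only [Pi.zero_apply]; positivity)]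
  have hlim : ∀ x : ℝ, ENNReal.ofReal (x ^ (n + 2)) =
      liminf (fun N : ℕ => ENNReal.ofReal (x ^ (n + 1) * min x N)) atTop := by
    intro x
    refine (Tendsto.liminf_eq (tendsto_const_nhds.congr' ?_)).symm
    obtain ⟨R, hR⟩ := exists_nat_ge x
    filter_upwards [eventually_ge_atTop R] with N hN
    rw [min_eq_left (hR.trans (by exact_mod_cast hN)), ← pow_succ]
  simp_rw [hlim]
  refine (lintegral_liminf_le fun N => by fun_prop).trans_lt
    (lt_of_le_of_lt ?_ (ENNReal.ofReal_lt_top (r := C)))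
  refine liminf_le_of_frequently_le' (Eventually.frequently ?_)
  filter_upwards [eventually_gt_atTop 0] with N hN
  rw [← ofReal_integral_eq_lintegral_ofReal (hI N (by positivity)) (hnn N (by positivity))]
  exact ENNReal.ofReal_le_ofReal (hC N (by exact_mod_cast hN))

theorem integrable_pow_succ_of_smoothing {β : ℝ} (hβ0 : 0 < β) (hβ1 : β < 1) {μ : Measure ℝ}
    [IsProbabilityMeasure μ] (hμ : ∀ᵐ x ∂μ, 0 ≤ x)
    (hfix : (μ.prod (μ.prod (dirichletMeasure β))).map (smoothingMap β) = μ) {n : ℕ}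
    (hint : ∀ k ≤ n + 1, Integrable (fun x => x ^ k) μ) :
    Integrable (fun x => x ^ (n + 2)) μ := by
  have := isProbabilityMeasure_dirichletMeasure hβ0 hβ1
  set P := μ.prod (μ.prod (dirichletMeasure β)) with hP
  have hn := hint (n + 1) le_rfl
  have hp1 : MeasurePreserving (fun q : ℝ × ℝ × (ℝ × ℝ) => (q.1, q.2.2)) P
      (μ.prod (dirichletMeasure β)) := (MeasurePreserving.id μ).prod measurePreserving_snd
  have hp2 : MeasurePreserving (fun q : ℝ × ℝ × (ℝ × ℝ) => q.2) P
      (μ.prod (dirichletMeasure β)) := measurePreserving_snd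
  have hae : ∀ᵐ q ∂P, 0 ≤ q.2.2.1 ^ β * q.1 ∧ 0 ≤ q.2.2.2 ^ β * q.2.1 := by
    have hq : ∀ᵐ q ∂(μ.prod (dirichletMeasure β)), 0 ≤ q.1 ∧ q.2 ∈ dirichletSupport :=
      (Measure.quasiMeasurePreserving_fst.ae hμ).and
        (Measure.quasiMeasurePreserving_snd.ae (ae_mem_dirichletSupport β))
    filter_upwards [hp1.quasiMeasurePreserving.ae hq, hp2.quasiMeasurePreserving.ae hq]
      with q ⟨h1, h2, _⟩ ⟨h3, h4, h5, _⟩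
    exact ⟨by positivity, by positivity⟩
  have hpos : ∀ᵐ q ∂dirichletMeasure β, 0 < q.1 ^ β ∧ 0 < q.2 ^ β := by
    filter_upwards [ae_mem_dirichletSupport β] with q ⟨h1, h2, _⟩
    exact ⟨by positivity, by positivity⟩
  have hi1 : ∀ k : ℕ, Integrable (fun q : ℝ × ℝ => (q.1 ^ β) ^ k) (dirichletMeasure β) :=
    fun k => by simpa using integrable_dirichletMeasure_pow hβ0 hβ1 k 0
  have hi2 : ∀ k : ℕ, Integrable (fun q : ℝ × ℝ => (q.2 ^ β) ^ k) (dirichletMeasure β) :=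
    fun k => by simpa using integrable_dirichletMeasure_pow hβ0 hβ1 0 k
  have hs1 := fun N hN => integral_scaled_truncation_le (N := N)
    (a := fun q : ℝ × ℝ => q.1 ^ β) (by fun_prop) (hpos.mono fun _ h => h.1) hi1
    (integral_dirichletMeasure_fst_pow hβ0 hβ1) hμ hn hN
  have hs2 := fun N hN => integral_scaled_truncation_le (N := N)
    (a := fun q : ℝ × ℝ => q.2 ^ β) (by fun_prop) (hpos.mono fun _ h => h.2) hi2
    (integral_dirichletMeasure_snd_pow hβ0 hβ1) hμ hn hN
  let R : ℝ × ℝ × (ℝ × ℝ) → ℝ := fun q => (q.2.2.1 ^ β * q.1 + q.2.2.2 ^ β * q.2.1) ^ (n + 2) -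
    (q.2.2.1 ^ β * q.1) ^ (n + 2) - (q.2.2.2 ^ β * q.2.1) ^ (n + 2)
  have hR : Integrable R P := by
    simp only [R, smoothing_remainder_eq]
    refine integrable_finsetSum _ fun k hk => ?_
    have hk := Finset.mem_range.1 hk
    exact (integrable_smoothing_monomial hβ0 hβ1 (hint (k + 1) (by omega))
      (hint (n + 1 - k) (by omega))).mul_const _
  set C := ∫ q, R q ∂P with hC
  have hC0 : 0 ≤ C := by
    refine integral_nonneg_of_ae ?_
    filter_upwards [hae] with q ⟨h1, h2⟩
    simp only [R, smoothing_remainder_eq, Pi.zero_apply]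
    positivity
  have hstep : ∀ ε K : ℝ, 0 ≤ ε → 0 ≤ K →
      (∀ N > 0, ∫ x, x ^ (n + 1) * min x N ∂μ ≤ ε * N + K) →
      ∀ N > 0, ∫ x, x ^ (n + 1) * min x N ∂μ ≤ ε * N + (2 / 3 * K + C) := by
    intro ε K hε hK h N hN
    obtain ⟨hI1, hb1⟩ := hs1 N hN
    obtain ⟨hI2, hb2⟩ := hs2 N hN
    have hb1 := hb1 ε K h
    have hb2 := hb2 ε K h
    have hI1' := hp1.integrable_comp_of_integrable hI1
    have hI2' := hp2.integrable_comp_of_integrable hI2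
    have he1 : ∫ q, ((q.2.2.1 ^ β * q.1) ^ (n + 1) * min (q.2.2.1 ^ β * q.1) N) ∂P = _ :=
      (integral_map (f := fun q : ℝ × ℝ × ℝ =>
        (q.2.1 ^ β * q.1) ^ (n + 1) * min (q.2.1 ^ β * q.1) N)
        hp1.measurable.aemeasurable (by fun_prop)).symm
    have he2 : ∫ q, ((q.2.2.2 ^ β * q.2.1) ^ (n + 1) * min (q.2.2.2 ^ β * q.2.1) N) ∂P = _ :=
      (integral_map (f := fun q : ℝ × ℝ × ℝ =>
        (q.2.2 ^ β * q.1) ^ (n + 1) * min (q.2.2 ^ β * q.1) N)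
        hp2.measurable.aemeasurable (by fun_prop)).symm
    rw [hp1.map_eq] at he1
    rw [hp2.map_eq] at he2
    have hle : ∫ x, x ^ (n + 1) * min x N ∂μ ≤
        ∫ q, ((q.2.2.1 ^ β * q.1) ^ (n + 1) * min (q.2.2.1 ^ β * q.1) N +
          (q.2.2.2 ^ β * q.2.1) ^ (n + 1) * min (q.2.2.2 ^ β * q.2.1) N + R q) ∂P := by
      conv_lhs => rw [← hfix]
      rw [integral_map (by fun_prop) (by fun_prop)]
      refine integral_mono_of_nonneg ?_ ((hI1'.add hI2').add hR) ?_
      · filter_upwards [hae] with q ⟨h1, h2⟩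
        have : 0 ≤ smoothingMap β q := add_nonneg h1 h2
        exact mul_nonneg (by positivity) (le_min this hN.le)
      · filter_upwards [hae] with q ⟨h1, h2⟩
        exact add_pow_mul_min_le h1 h2 hN.le n
    have hsum : ∫ q, ((q.2.2.1 ^ β * q.1) ^ (n + 1) * min (q.2.2.1 ^ β * q.1) N +
          (q.2.2.2 ^ β * q.2.1) ^ (n + 1) * min (q.2.2.2 ^ β * q.2.1) N + R q) ∂P =
        ∫ q, ((q.2.2.1 ^ β * q.1) ^ (n + 1) * min (q.2.2.1 ^ β * q.1) N) ∂P +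
        ∫ q, ((q.2.2.2 ^ β * q.2.1) ^ (n + 1) * min (q.2.2.2 ^ β * q.2.1) N) ∂P + C :=
      (integral_add (hI1'.add hI2') hR).trans (congrArg (· + C) (integral_add hI1' hI2'))
    have hε' : ε * N / (n + 2) ≤ ε * N / 2 := by
      gcongr; linarith [Nat.cast_nonneg (α := ℝ) n]
    have hK' : K / (n + 3) ≤ K / 3 := by
      gcongr; linarith [Nat.cast_nonneg (α := ℝ) n]
    rw [hsum, he1, he2] at hle
    linarith
  refine integrable_pow_of_truncated_moment_le hμ hn (C := 3 * C) fun N hN => ?_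
  have hbound : ∀ ε > 0, ∫ x, x ^ (n + 1) * min x N ∂μ ≤ ε * N + 3 * C := by
    intro ε hε
    obtain ⟨K, hK, hKb⟩ := exists_truncated_moment_le hμ hn hε
    have hiter : ∀ j : ℕ, ∀ N > 0, ∫ x, x ^ (n + 1) * min x N ∂μ ≤
        ε * N + (3 * C + (2 / 3) ^ j * K) := by
      intro j
      induction j with
      | zero =>
        intro N hN
        have := hKb N hN
        simp only [pow_zero, one_mul]
        linarith
      | succ j ih =>
        intro N hN
        refine (hstep ε _ hε.le (by positivity) ih N hN).trans_eq ?_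
        ring
    have hlim : Tendsto (fun j : ℕ => ε * N + (3 * C + (2 / 3 : ℝ) ^ j * K)) atTop
        (𝓝 (ε * N + (3 * C + 0 * K))) :=
      ((tendsto_pow_atTop_nhds_zero_of_lt_one (by norm_num) (by norm_num)).mul_const K
        |>.const_add _).const_add _
    simpa using ge_of_tendsto' hlim fun j => hiter j N hN
  refine le_of_forall_pos_le_add fun δ hδ => ?_
  have := hbound (δ / N) (by positivity)
  rw [div_mul_cancel₀ _ hN.ne'] at this
  linarith

/-- The moments of the size-biased Mittag-Leffler distribution. -/
noncomputable def sizeBiasedMLMoment (β : ℝ) (p : ℕ) : ℝ :=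
  Real.Gamma (β + 1) * Real.Gamma ((p : ℝ) + 2) / Real.Gamma (((p : ℝ) + 1) * β + 1)

theorem sizeBiasedMLMoment_pos {β : ℝ} (hβ0 : 0 < β) (p : ℕ) : 0 < sizeBiasedMLMoment β p := by
  have := Real.Gamma_pos_of_pos (show 0 < β + 1 by linarith)
  have := Real.Gamma_pos_of_pos (show 0 < (p : ℝ) + 2 by positivity)
  have := Real.Gamma_pos_of_pos (show 0 < (p + 1) * β + 1 by positivity)
  unfold sizeBiasedMLMoment
  positivity

theorem sizeBiasedMLMoment_zero {β : ℝ} (hβ0 : 0 < β) : sizeBiasedMLMoment β 0 = 1 := by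
  have := Real.Gamma_pos_of_pos (show 0 < β + 1 by linarith)
  simp [sizeBiasedMLMoment, this.ne']

theorem Gamma_natCast_add_two (p : ℕ) : Real.Gamma ((p : ℝ) + 2) = (p + 1).factorial := by
  rw [← Real.Gamma_nat_eq_factorial]
  congr 1
  push_cast
  ring

theorem sizeBiasedMLMoment_mul_Gamma {β : ℝ} (hβ0 : 0 < β) (p : ℕ) :
    sizeBiasedMLMoment β p * Real.Gamma ((p + 1) * β) = Real.Gamma β * p.factorial := by
  have := Real.Gamma_pos_of_pos (show 0 < (p + 1) * β by positivity)
  rw [sizeBiasedMLMoment, Gamma_natCast_add_two, Real.Gamma_add_one hβ0.ne',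
    Real.Gamma_add_one (by positivity), Nat.factorial_succ]
  push_cast
  field_simp

theorem sum_sizeBiasedMLMoment {β : ℝ} (hβ0 : 0 < β) (p : ℕ) :
    ∑ k ∈ Finset.range (p + 1),
      sizeBiasedMLMoment β k * sizeBiasedMLMoment β (p - k) * p.choose k *
        (Real.Gamma (β + 1) * Real.Gamma ((k + 1) * β) * Real.Gamma (((p - k : ℕ) + 1) * β) /
          (Real.Gamma β ^ 2 * Real.Gamma ((p + 1) * β + 1))) = sizeBiasedMLMoment β p := by
  have hg := Real.Gamma_pos_of_pos hβ0
  have hterm : ∀ k ∈ Finset.range (p + 1),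
      sizeBiasedMLMoment β k * sizeBiasedMLMoment β (p - k) * p.choose k *
        (Real.Gamma (β + 1) * Real.Gamma ((k + 1) * β) * Real.Gamma (((p - k : ℕ) + 1) * β) /
          (Real.Gamma β ^ 2 * Real.Gamma ((p + 1) * β + 1))) =
      Real.Gamma (β + 1) * p.factorial / Real.Gamma ((p + 1) * β + 1) := by
    intro k hk
    have hk : k ≤ p := Nat.lt_succ_iff.1 (Finset.mem_range.1 hk)
    calc _ = (sizeBiasedMLMoment β k * Real.Gamma ((k + 1) * β)) *
          (sizeBiasedMLMoment β (p - k) * Real.Gamma (((p - k : ℕ) + 1) * β)) * p.choose k *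
          Real.Gamma (β + 1) / (Real.Gamma β ^ 2 * Real.Gamma ((p + 1) * β + 1)) := by ring
      _ = _ := by
        rw [sizeBiasedMLMoment_mul_Gamma hβ0, sizeBiasedMLMoment_mul_Gamma hβ0,
          ← Nat.choose_mul_factorial_mul_factorial hk]
        push_cast
        field_simp
  rw [Finset.sum_congr rfl hterm, Finset.sum_const, Finset.card_range, sizeBiasedMLMoment,
    Gamma_natCast_add_two, Nat.factorial_succ]
  simp only [nsmul_eq_mul, Nat.cast_mul, Nat.cast_add, Nat.cast_one]
  ring

theorem moment_eq_of_smoothing {β : ℝ} (hβ0 : 0 < β) (hβ1 : β < 1) {μ : Measure ℝ}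
    [IsProbabilityMeasure μ] (hμ : ∀ᵐ x ∂μ, 0 ≤ x)
    (hfix : (μ.prod (μ.prod (dirichletMeasure β))).map (smoothingMap β) = μ)
    (hmean : ∫ x, x ∂μ = sizeBiasedMLMoment β 1) (p : ℕ) :
    Integrable (fun x => x ^ p) μ ∧ ∫ x, x ^ p ∂μ = sizeBiasedMLMoment β p := by
  induction p using Nat.strong_induction_on with
  | _ p ih =>
  match p, ih with
  | 0, _ => simp [sizeBiasedMLMoment_zero hβ0]
  | 1, _ =>
    simp only [pow_one, hmean, and_true]
    refine Integrable.of_integral_ne_zero ?_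
    rw [hmean]
    exact (sizeBiasedMLMoment_pos hβ0 1).ne'
  | n + 2, ih =>
    have hint := integrable_pow_succ_of_smoothing hβ0 hβ1 hμ hfix (n := n)
      fun k hk => (ih k (by omega)).1
    refine ⟨hint, ?_⟩
    have hall : ∀ k ≤ n + 2, Integrable (fun x => x ^ k) μ := fun k hk =>
      hk.eq_or_lt.elim (fun h => h ▸ hint) fun h => (ih k h).1
    have h1 := integral_smoothingMap_pow hβ0 hβ1 hall
    have h2 := sum_sizeBiasedMLMoment hβ0 (n + 2)
    have h3 : ∫ x, x ^ (n + 2) ∂μ = ∫ q, smoothingMap β q ^ (n + 2)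
        ∂(μ.prod (μ.prod (dirichletMeasure β))) := by
      conv_lhs => rw [← hfix]
      rw [integral_map (by fun_prop) (by fun_prop)]
    rw [← h3, Finset.sum_range_succ, Finset.sum_range_succ'] at h1
    rw [Finset.sum_range_succ, Finset.sum_range_succ'] at h2
    have hmid : ∀ k ∈ Finset.range (n + 1), ∫ x, x ^ (k + 1) ∂μ = sizeBiasedMLMoment β (k + 1) ∧
        ∫ x, x ^ (n + 2 - (k + 1)) ∂μ = sizeBiasedMLMoment β (n + 2 - (k + 1)) := by
      intro k hk
      have hk := Finset.mem_range.1 hk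
      exact ⟨(ih _ (by omega)).2, (ih _ (by omega)).2⟩
    rw [Finset.sum_congr rfl fun k hk => by rw [(hmid k hk).1, (hmid k hk).2]] at h1
    have hend : Real.Gamma (β + 1) * Real.Gamma β * Real.Gamma ((n + 2 + 1) * β) /
        (Real.Gamma β ^ 2 * Real.Gamma ((n + 2 + 1) * β + 1)) = 1 / (n + 3) := by
      have := Real.Gamma_pos_of_pos hβ0
      have := Real.Gamma_pos_of_pos (show 0 < ((n : ℝ) + 2 + 1) * β by positivity)
      rw [Real.Gamma_add_one hβ0.ne', Real.Gamma_add_one (by positivity)]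
      field_simp
      ring
    have hend' : Real.Gamma (β + 1) * Real.Gamma ((n + 2 + 1) * β) * Real.Gamma β /
        (Real.Gamma β ^ 2 * Real.Gamma ((n + 2 + 1) * β + 1)) = 1 / (n + 3) := by
      rw [← hend]; ring
    simp only [pow_zero, integral_const, probReal_univ, smul_eq_mul, mul_one, one_mul,
      Nat.choose_zero_right, Nat.choose_self, Nat.cast_one, tsub_zero, tsub_self, Nat.cast_add,
      Nat.cast_ofNat, Nat.cast_zero, zero_add, hend, hend', sizeBiasedMLMoment_zero hβ0] at h1 h2
    have hsub : (∫ x, x ^ (n + 2) ∂μ - sizeBiasedMLMoment β (n + 2)) * (1 - 2 / (n + 3)) = 0 := by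
      linear_combination h1 + h2
    have hne : (1 : ℝ) - 2 / (n + 3) ≠ 0 := by
      have : (2 : ℝ) / (n + 3) < 1 := by
        rw [div_lt_one (by positivity)]
        linarith [Nat.cast_nonneg (α := ℝ) n]
      linarith
    exact sub_eq_zero.1 ((mul_eq_zero.1 hsub).resolve_right hne)

theorem integral_smoothingMap_pow_eq_moment {β : ℝ} (hβ0 : 0 < β) (hβ1 : β < 1) {μ : Measure ℝ}
    [SFinite μ] (hmom : ∀ p : ℕ, ∫ x, x ^ p ∂μ = sizeBiasedMLMoment β p) (p : ℕ) :
    ∫ q, smoothingMap β q ^ p ∂(μ.prod (μ.prod (dirichletMeasure β))) =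
      sizeBiasedMLMoment β p := by
  rw [integral_smoothingMap_pow hβ0 hβ1 fun k _ =>
    Integrable.of_integral_ne_zero (by rw [hmom]; exact (sizeBiasedMLMoment_pos hβ0 k).ne')]
  simp only [hmom]
  exact sum_sizeBiasedMLMoment hβ0 p

theorem integrable_exp_half_of_moment_le {μ : Measure ℝ} (hμ : ∀ᵐ x ∂μ, 0 ≤ x)
    (hint : ∀ n : ℕ, Integrable (fun x => x ^ n) μ) {C : ℝ}
    (hmom : ∀ n : ℕ, ∫ x, x ^ n ∂μ ≤ C * (n + 1).factorial) :
    Integrable (fun x => Real.exp (1 / 2 * x)) μ := by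
  refine ⟨by fun_prop, ?_⟩
  rw [hasFiniteIntegral_iff_ofReal (ae_of_all _ fun x => (Real.exp_pos _).le)]
  have hexp : ∀ᵐ x ∂μ, ENNReal.ofReal (Real.exp (1 / 2 * x)) =
      ∑' n : ℕ, ENNReal.ofReal (x ^ n * ((1 / 2) ^ n / n.factorial)) := by
    filter_upwards [hμ] with x hx
    have hs : HasSum (fun n : ℕ => x ^ n * ((1 / 2) ^ n / n.factorial))
        (Real.exp (1 / 2 * x)) := by
      have := NormedSpace.expSeries_div_hasSum_exp (𝔸 := ℝ) (1 / 2 * x)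
      rw [← Real.exp_eq_exp_ℝ] at this
      have heq : ∀ n : ℕ, x ^ n * ((1 / 2) ^ n / n.factorial) =
          (1 / 2 * x) ^ n / n.factorial := fun n => by rw [mul_pow]; ring
      simpa only [heq] using this
    rw [← hs.tsum_eq, ENNReal.ofReal_tsum_of_nonneg (fun n => by positivity) hs.summable]
  rw [lintegral_congr_ae hexp, lintegral_tsum fun n => by fun_prop]
  have hsum : Summable fun n : ℕ => C * ((n : ℝ) ^ 1 * (1 / 2) ^ n + (1 / 2) ^ n) :=
    ((summable_pow_mul_geometric_of_norm_lt_one 1 (by norm_num)).add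
      (summable_geometric_of_lt_one (by norm_num) (by norm_num))).mul_left C
  refine lt_of_le_of_lt (ENNReal.tsum_le_tsum fun n => ?_) (hsum.tsum_ofReal_lt_top)
  rw [← ofReal_integral_eq_lintegral_ofReal ((hint n).mul_const _), integral_mul_const]
  · refine ENNReal.ofReal_le_ofReal ?_
    calc _ ≤ C * (n + 1).factorial * ((1 / 2) ^ n / n.factorial) := by
          gcongr; exact hmom n
      _ = _ := by
          rw [Nat.factorial_succ]
          push_cast
          field_simp
  · filter_upwards [hμ] with x hx
    simp only [Pi.zero_apply]
    positivity

theorem zero_mem_interior_integrableExpSet {μ : Measure ℝ} [IsFiniteMeasure μ]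
    (hμ : ∀ᵐ x ∂μ, 0 ≤ x) {t : ℝ} (ht : 0 < t)
    (hint : Integrable (fun x => Real.exp (t * x)) μ) :
    0 ∈ interior (integrableExpSet id μ) := by
  rw [mem_interior_iff_mem_nhds]
  filter_upwards [Iio_mem_nhds ht] with s hs
  refine Integrable.mono' hint (by fun_prop) ?_
  filter_upwards [hμ] with x hx
  rw [Real.norm_of_nonneg (Real.exp_pos _).le, id]
  gcongr
  exact (Set.mem_Iio.1 hs).le

theorem ext_of_moments {μ ν : Measure ℝ} [IsFiniteMeasure μ] [IsFiniteMeasure ν]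
    (hμ : 0 ∈ interior (integrableExpSet id μ)) (hν : 0 ∈ interior (integrableExpSet id ν))
    (h : ∀ n : ℕ, ∫ x, x ^ n ∂μ = ∫ x, x ^ n ∂ν) : μ = ν := by
  have hderiv : ∀ n : ℕ, iteratedDeriv n (complexMGF id μ) 0 =
      iteratedDeriv n (complexMGF id ν) 0 := by
    intro n
    rw [iteratedDeriv_complexMGF (by simpa using hμ), iteratedDeriv_complexMGF (by simpa using hν)]
    simp only [id, zero_mul, Complex.exp_zero, mul_one, ← Complex.ofReal_pow]
    rw [integral_complex_ofReal, integral_complex_ofReal, h]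
  set U : Set ℂ := {z | z.re ∈ interior (integrableExpSet id μ) ∩
    interior (integrableExpSet id ν)} with hU
  have hUc : Convex ℝ U :=
    ((convex_integrableExpSet.interior.inter convex_integrableExpSet.interior)).linear_preimage
      Complex.reLm
  have hμa : AnalyticOnNhd ℂ (complexMGF id μ) U := fun z hz => analyticAt_complexMGF hz.1
  have hνa : AnalyticOnNhd ℂ (complexMGF id ν) U := fun z hz => analyticAt_complexMGF hz.2
  have h0 : (0 : ℂ) ∈ U := ⟨by simpa using hμ, by simpa using hν⟩
  have hloc : complexMGF id μ =ᶠ[𝓝 0] complexMGF id ν := by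
    have h1 := (hμa 0 h0).hasFPowerSeriesAt
    have h2 := (hνa 0 h0).hasFPowerSeriesAt
    simp only [hderiv] at h1
    filter_upwards [h1.eventually_hasSum_sub, h2.eventually_hasSum_sub] with z hz1 hz2
    exact hz1.unique hz2
  have heq := hμa.eqOn_of_preconnected_of_eventuallyEq hνa hUc.isPreconnected h0 hloc
  refine Measure.ext_of_charFun (funext fun t => ?_)
  rw [← complexMGF_id_mul_I, ← complexMGF_id_mul_I]
  exact heq ⟨by simpa using hμ, by simpa using hν⟩

theorem exists_sizeBiasedMLMoment_le {β : ℝ} (hβ0 : 0 < β) :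
    ∃ C : ℝ, ∀ p : ℕ, sizeBiasedMLMoment β p ≤ C * (p + 1).factorial := by
  obtain ⟨x, hx, hmin⟩ := Real.exists_isMinOn_Gamma_Ioi
  have hx0 := Real.Gamma_pos_of_pos (show 0 < x by linarith [hx.1])
  have hg := Real.Gamma_pos_of_pos (show 0 < β + 1 by linarith)
  refine ⟨Real.Gamma (β + 1) / Real.Gamma x, fun p => ?_⟩
  have hle : Real.Gamma x ≤ Real.Gamma ((p + 1) * β + 1) :=
    hmin (Set.mem_Ioi.2 (by positivity))
  rw [sizeBiasedMLMoment, Gamma_natCast_add_two, div_mul_eq_mul_div]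
  gcongr

theorem eq_of_sizeBiasedMLMoment {β : ℝ} (hβ0 : 0 < β) {μ ν : Measure ℝ} [IsFiniteMeasure μ]
    [IsFiniteMeasure ν] (hμ : ∀ᵐ x ∂μ, 0 ≤ x) (hν : ∀ᵐ x ∂ν, 0 ≤ x)
    (hμm : ∀ p : ℕ, ∫ x, x ^ p ∂μ = sizeBiasedMLMoment β p)
    (hνm : ∀ p : ℕ, ∫ x, x ^ p ∂ν = sizeBiasedMLMoment β p) : μ = ν := by
  obtain ⟨C, hCm⟩ := exists_sizeBiasedMLMoment_le hβ0
  have key : ∀ ρ : Measure ℝ, IsFiniteMeasure ρ → (∀ᵐ x ∂ρ, 0 ≤ x) →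
      (∀ p : ℕ, ∫ x, x ^ p ∂ρ = sizeBiasedMLMoment β p) →
      0 ∈ interior (integrableExpSet id ρ) := fun ρ _ hρ hρm =>
    zero_mem_interior_integrableExpSet hρ one_half_pos
      (integrable_exp_half_of_moment_le hρ
        (fun n => Integrable.of_integral_ne_zero
          (by rw [hρm]; exact (sizeBiasedMLMoment_pos hβ0 n).ne'))
        fun n => (hρm n).trans_le (hCm n))
  exact ext_of_moments (key μ inferInstance hμ hμm) (key ν inferInstance hν hνm)
    fun n => (hμm n).trans (hνm n).symm

/-- Characterization of the size-biased Mittag-Leffler law: for `β ∈ [1/2,1)` and a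
Borel probability measure `μ` on `[0,∞)` with mean `2Γ(β+1)/Γ(2β+1)`, the law of
`X₁^β·M₁ + X₂^β·M₂` (with `M₁, M₂` i.i.d. `μ` independent of
`(X₁,X₂) ~ Dirichlet(β,β,1−β)`) equals `μ` if and only if `μ` has the moments of the
size-biased Mittag-Leffler distribution with parameter `β`:
`∫ x^p dμ = Γ(β+1)Γ(p+2)/Γ((p+1)β+1)` for every integer `p ≥ 0`. -/
theorem sizeBiasedML_characterization (β : ℝ) (hβ : β ∈ Set.Ico (1 / 2 : ℝ) 1)
    (μ : Measure ℝ) [IsProbabilityMeasure μ]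
    (hsupp : μ (Set.Iio 0) = 0)
    (hmean : ∫ x, x ∂μ = 2 * Real.Gamma (β + 1) / Real.Gamma (2 * β + 1)) :
    Measure.map (fun q : ℝ × ℝ × (ℝ × ℝ) => q.2.2.1 ^ β * q.1 + q.2.2.2 ^ β * q.2.1)
        (μ.prod (μ.prod (dirichletMeasure β))) = μ ↔
      ∀ p : ℕ, ∫ x, x ^ p ∂μ =
        Real.Gamma (β + 1) * Real.Gamma ((p : ℝ) + 2) / Real.Gamma (((p : ℝ) + 1) * β + 1) := by
  obtain ⟨hβ, hβ1⟩ := hβ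
  have hβ0 : 0 < β := by linarith
  have hμ : ∀ᵐ x ∂μ, 0 ≤ x := by
    rw [ae_iff]
    simp only [not_le]
    exact hsupp
  change Measure.map (smoothingMap β) _ = μ ↔ ∀ p : ℕ, _ = sizeBiasedMLMoment β p
  refine ⟨fun hfix p => ?_, fun hmom => ?_⟩
  · refine (moment_eq_of_smoothing hβ0 hβ1 hμ hfix (hmean.trans ?_) p).2
    rw [sizeBiasedMLMoment, Gamma_natCast_add_two]
    norm_num [mul_comm]
  · have := isProbabilityMeasure_dirichletMeasure hβ0 hβ1
    have hnn : ∀ᵐ q ∂(μ.prod (μ.prod (dirichletMeasure β))), 0 ≤ smoothingMap β q := by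
      have h2 : ∀ᵐ q ∂(μ.prod (dirichletMeasure β)), 0 ≤ q.1 ∧ q.2 ∈ dirichletSupport :=
        (Measure.quasiMeasurePreserving_fst.ae hμ).and
          (Measure.quasiMeasurePreserving_snd.ae (ae_mem_dirichletSupport β))
      filter_upwards [Measure.quasiMeasurePreserving_fst.ae hμ,
        Measure.quasiMeasurePreserving_snd.ae h2] with q h1 ⟨h2, h3, h4, _⟩
      unfold smoothingMap
      positivity
    have : IsProbabilityMeasure
        ((μ.prod (μ.prod (dirichletMeasure β))).map (smoothingMap β)) :=
      Measure.isProbabilityMeasure_map (by fun_prop)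
    refine eq_of_sizeBiasedMLMoment hβ0 ?_ hμ (fun p => ?_) hmom
    · exact (ae_map_iff (by fun_prop) measurableSet_Ici).2 hnn
    · rw [integral_map (by fun_prop) (by fun_prop)]
      exact integral_smoothingMap_pow_eq_moment hβ0 hβ1 hmom p
end

section
/- Let (Ω, 𝓕, P) be a probability space, 𝓖 ⊆ 𝓕 a sub-σ-algebra, and X : Ω → ℝ an integrable random variable. If the conditional expectation E[X | 𝓖] has the same distribution as X (i.e. the pushforward laws of X and of E[X | 𝓖] under P coincide), then X = E[X | 𝓖] almost surely; in particular X is almost surely equal to a 𝓖-measurable random variable. -/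
open MeasureTheory

/-- A random variable with the same law as its conditional expectation lies almost surely on the
same side of any given level as that conditional expectation. -/
theorem ae_le_and_le_of_map_eq_map_condExp {Ω : Type*} {m mΩ : MeasurableSpace Ω} (hm : m ≤ mΩ)
    {μ : Measure Ω} [IsFiniteMeasure μ] {X : Ω → ℝ} (hX : Integrable X μ)
    (hlaw : μ.map X = μ.map (μ[X|m])) (c : ℝ) :
    ∀ᵐ ω ∂μ, (c < μ[X|m] ω → c ≤ X ω) ∧ (μ[X|m] ω ≤ c → X ω ≤ c) := by
  set Y := μ[X|m]
  have hYm : Measurable[m] Y := stronglyMeasurable_condExp.measurable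
  have hY : Integrable Y μ := integrable_condExp
  set S : Set Ω := {ω | c < Y ω}
  have hSm : MeasurableSet[m] S := hYm measurableSet_Ioi
  have hS : MeasurableSet S := hm _ hSm
  have hXc : Integrable (fun ω ↦ X ω - c) μ := hX.sub (integrable_const c)
  have hpos : ∫ ω, max (X ω - c) 0 ∂μ = ∫ ω, max (Y ω - c) 0 ∂μ := by
    have hφ : Measurable fun x : ℝ ↦ max (x - c) 0 := by fun_prop
    rw [← integral_map (φ := X) (f := fun x ↦ max (x - c) 0) hX.aemeasurable
        hφ.aestronglyMeasurable, hlaw,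
      integral_map hY.aemeasurable hφ.aestronglyMeasurable]
  have hind : ∫ ω, S.indicator (fun ω ↦ X ω - c) ω ∂μ = ∫ ω, max (Y ω - c) 0 ∂μ := by
    have hmax : (fun ω ↦ max (Y ω - c) 0) = S.indicator fun ω ↦ Y ω - c := by
      ext ω
      by_cases h : c < Y ω
      · rw [Set.indicator_of_mem (show ω ∈ S from h), max_eq_left (by linarith)]
      · rw [Set.indicator_of_notMem (show ω ∉ S from h), max_eq_right (by linarith)]
    rw [hmax, integral_indicator hS, integral_indicator hS,
      integral_sub hX.integrableOn (integrable_const c).integrableOn,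
      integral_sub hY.integrableOn (integrable_const c).integrableOn,
      setIntegral_condExp hm hX hSm]
  have hle : S.indicator (fun ω ↦ X ω - c) ≤ᵐ[μ] fun ω ↦ max (X ω - c) 0 :=
    .of_forall <| Set.indicator_le' (fun _ _ ↦ le_max_left _ _) fun _ _ ↦ le_max_right _ _
  have heq := (integral_eq_iff_of_ae_le (hXc.indicator hS) hXc.pos_part hle).1
    (hind.trans hpos.symm)
  filter_upwards [heq] with ω hω
  refine ⟨fun h ↦ ?_, fun h ↦ ?_⟩
  · rw [Set.indicator_of_mem (show ω ∈ S from h)] at hω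
    linarith [le_max_right (X ω - c) 0]
  · rw [Set.indicator_of_notMem (show ω ∉ S from not_lt.2 h)] at hω
    linarith [le_max_left (X ω - c) 0]

/-- If an integrable random variable `X` has the same distribution as its conditional
expectation `E[X | 𝒢]`, then `X = E[X | 𝒢]` almost surely; in particular `X` is almost
surely equal to a `𝒢`-measurable random variable. -/
theorem eq_condexp_of_map_eq_map {Ω : Type*} (𝒢 : MeasurableSpace Ω)
    {mΩ : MeasurableSpace Ω} (h𝒢 : 𝒢 ≤ mΩ)
    (P : Measure Ω) [IsProbabilityMeasure P]
    (X : Ω → ℝ) (hXm : Measurable X) (hXint : Integrable X P)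
    (hlaw : P.map X = P.map (P[X|𝒢])) :
    X =ᵐ[P] P[X|𝒢] ∧ ∃ Z : Ω → ℝ, Measurable[𝒢] Z ∧ X =ᵐ[P] Z := by
  have hXY : X =ᵐ[P] P[X|𝒢] := by
    filter_upwards [ae_all_iff.2 fun q : ℚ ↦
      ae_le_and_le_of_map_eq_map_condExp h𝒢 hXint hlaw q] with ω hω
    refine le_antisymm (le_of_not_gt fun h ↦ ?_) (le_of_not_gt fun h ↦ ?_)
    · obtain ⟨q, hq₁, hq₂⟩ := exists_rat_btwn h
      exact hq₂.not_ge ((hω q).2 hq₁.le)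
    · obtain ⟨q, hq₁, hq₂⟩ := exists_rat_btwn h
      exact hq₁.not_ge ((hω q).1 hq₂)
  exact ⟨hXY, P[X|𝒢], stronglyMeasurable_condExp.measurable, hXY⟩
end
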